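/- arXiv:2303.13259 — 3 statements merged into one kernel-verified Lean document; each statement's English description precedes it below -/
import Mathlib

section
/- Let g be a smooth metric on ℝ^n whose matrix g(x) is invertible at every point, with pointwise inverse g^{··}, let Γ0_{kij} = ½(∂_i g_{jk} + ∂_j g_{ik} − ∂_k g_{ij}), Γ0^m_{ij} = Σ_l g^{ml} Γ0_{lij}, and let A_{ijk} : ℝ^n → ℝ be a smooth totally antisymmetric (0,3)-tensor field (changing sign under transposition of any two indices). Define Γ^m_{ij} = Γ0^m_{ij} + Σ_l g^{ml} A_{lij} and let Γ⋆ be the torsion dual of Γ, i.e. Γ⋆^m_{ij} = Γ^m_{ji}. Then for all i,j,k,l at every point: Σ_m g_{im} R(Γ)^m_{jkl} + Σ_m g_{jm} R(Γ⋆)^m_{ikl} = 2·(∇0_k A_{ijl} − ∇0_l A_{ijk}). In particular, if R(Γ) vanishes identically, then Σ_m g_{jm} R(Γ⋆)^m_{ikl} = 2·(∇0_k A_{ijl} − ∇0_l A_{ijk}). -/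
noncomputable section
open scoped BigOperators

/-- The `i`-th partial derivative of `f : ℝⁿ → ℝ` at `x`. -/
def pd {n : ℕ} (i : Fin n) (f : EuclideanSpace ℝ (Fin n) → ℝ)
    (x : EuclideanSpace ℝ (Fin n)) : ℝ :=
  fderiv ℝ f x (EuclideanSpace.single i 1)

/-- Lowered Levi-Civita (Koszul) coefficients Γ0_{kij}. -/
def LC {n : ℕ} (g : EuclideanSpace ℝ (Fin n) → Fin n → Fin n → ℝ)
    (k i j : Fin n) (x : EuclideanSpace ℝ (Fin n)) : ℝ :=
  (pd i (fun y => g y j k) x + pd j (fun y => g y i k) x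
    - pd k (fun y => g y i j) x) / 2

/-- Riemann curvature tensor R(Γ)^m_{ijk} of a connection given by
coefficients `Γ m i j = Γ^m_{ij}`. -/
def Riem {n : ℕ} (Γ : Fin n → Fin n → Fin n → EuclideanSpace ℝ (Fin n) → ℝ)
    (m i j k : Fin n) (x : EuclideanSpace ℝ (Fin n)) : ℝ :=
  pd j (Γ m i k) x - pd k (Γ m i j) x
    + ∑ l, (Γ m l j x * Γ l i k x - Γ m l k x * Γ l i j x)

/-- Levi-Civita covariant derivative ∇0_k N_{ijl} of a (0,3)-tensor field `N`. -/
def covD {n : ℕ} (g ginv : EuclideanSpace ℝ (Fin n) → Fin n → Fin n → ℝ)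
    (N : Fin n → Fin n → Fin n → EuclideanSpace ℝ (Fin n) → ℝ)
    (k i j l : Fin n) (x : EuclideanSpace ℝ (Fin n)) : ℝ :=
  pd k (fun y => N i j l y) x
    - ∑ m, ((∑ c, ginv x m c * LC g c i k x) * N m j l x
          + (∑ c, ginv x m c * LC g c j k x) * N i m l x
          + (∑ c, ginv x m c * LC g c l k x) * N i j m x)


theorem ContDiff.matrix_det {E ι : Type*} [NormedAddCommGroup E] [NormedSpace ℝ E]
    [Fintype ι] [DecidableEq ι] {r : WithTop ℕ∞} {M : E → Matrix ι ι ℝ}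
    (hM : ∀ i j, ContDiff ℝ r fun x => M x i j) : ContDiff ℝ r fun x => (M x).det := by
  simp only [Matrix.det_apply]
  exact ContDiff.sum fun σ _ => (contDiff_prod fun i _ => hM (σ i) i).const_smul _

theorem ContDiff.matrix_inv_apply {E ι : Type*} [NormedAddCommGroup E] [NormedSpace ℝ E]
    [Fintype ι] [DecidableEq ι] {r : WithTop ℕ∞} {M : E → Matrix ι ι ℝ}
    (hM : ∀ i j, ContDiff ℝ r fun x => M x i j) (hdet : ∀ x, (M x).det ≠ 0) (i j : ι) :
    ContDiff ℝ r fun x => (M x)⁻¹ i j := by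
  simp only [Matrix.inv_def, Ring.inverse_eq_inv', Matrix.smul_apply, smul_eq_mul,
    Matrix.adjugate_apply]
  refine ((ContDiff.matrix_det hM).inv hdet).mul (ContDiff.matrix_det fun a b => ?_)
  by_cases h : a = j
  · subst h
    simpa using contDiff_const
  · simpa [Matrix.updateRow_ne h] using hM a b

section PartialDerivative

variable {n : ℕ} {f h : EuclideanSpace ℝ (Fin n) → ℝ} {x : EuclideanSpace ℝ (Fin n)}

theorem contDiff_pd (hf : ContDiff ℝ (⊤ : ℕ∞) f) (i : Fin n) :
    ContDiff ℝ (⊤ : ℕ∞) (pd i f) :=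
  (hf.fderiv_right (m := (⊤ : ℕ∞)) (by simp)).clm_apply contDiff_const

theorem pd_add (hf : DifferentiableAt ℝ f x) (hh : DifferentiableAt ℝ h x) (i : Fin n) :
    pd i (fun y => f y + h y) x = pd i f x + pd i h x := by
  simp [pd, fderiv_fun_add hf hh]

theorem pd_const_mul (hf : DifferentiableAt ℝ f x) (c : ℝ) (i : Fin n) :
    pd i (fun y => c * f y) x = c * pd i f x := by
  simp [pd, fderiv_const_mul hf]

theorem pd_mul (hf : DifferentiableAt ℝ f x) (hh : DifferentiableAt ℝ h x) (i : Fin n) :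
    pd i (fun y => f y * h y) x = f x * pd i h x + pd i f x * h x := by
  simp [pd, fderiv_fun_mul hf hh, mul_comm]

theorem pd_sum {ι : Type*} {s : Finset ι} {F : ι → EuclideanSpace ℝ (Fin n) → ℝ}
    (hF : ∀ a ∈ s, DifferentiableAt ℝ (F a) x) (i : Fin n) :
    pd i (fun y => ∑ a ∈ s, F a y) x = ∑ a ∈ s, pd i (F a) x := by
  simp [pd, fderiv_fun_sum hF]

theorem pd_comm (hf : ContDiff ℝ (⊤ : ℕ∞) f) (i j : Fin n) :
    pd i (pd j f) x = pd j (pd i f) x := by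
  have hd : DifferentiableAt ℝ (fderiv ℝ f) x :=
    ((hf.fderiv_right (m := (⊤ : ℕ∞)) (by simp)).differentiable (by simp)).differentiableAt
  have key : ∀ a b : Fin n, pd a (pd b f) x =
      fderiv ℝ (fderiv ℝ f) x (EuclideanSpace.single a 1) (EuclideanSpace.single b 1) := by
    intro a b
    unfold pd
    rw [fderiv_clm_apply hd (differentiableAt_const _)]
    simp
  rw [key, key]
  exact (hf.contDiffAt.isSymmSndFDerivAt (by
    rw [minSmoothness_of_isRCLikeNormedField]
    exact WithTop.coe_le_coe.2 (le_top : (2 : ℕ∞) ≤ ⊤))).eq _ _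

end PartialDerivative

section MetricConnection

variable {n : ℕ} {g : EuclideanSpace ℝ (Fin n) → Fin n → Fin n → ℝ}

theorem contDiff_LC (hg : ∀ j k, ContDiff ℝ (⊤ : ℕ∞) fun x => g x j k) (k i j : Fin n) :
    ContDiff ℝ (⊤ : ℕ∞) (LC g k i j) :=
  (((contDiff_pd (hg j k) i).add (contDiff_pd (hg i k) j)).sub
    (contDiff_pd (hg i j) k)).div_const 2

theorem LC_symm (hg : ∀ x j k, g x j k = g x k j) (k i j : Fin n)
    (x : EuclideanSpace ℝ (Fin n)) : LC g k i j x = LC g k j i x := by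
  simp only [LC, hg _ i j]
  ring

theorem LC_add_LC (hg : ∀ x j k, g x j k = g x k j) (i m k : Fin n)
    (x : EuclideanSpace ℝ (Fin n)) :
    LC g i m k x + LC g m i k x = pd k (fun y => g y i m) x := by
  simp only [LC, hg _ m k, hg _ i k, hg _ m i]
  ring

/-- The curvature of a metric-compatible connection with the upper index lowered, in terms of
the lowered coefficients `G`. -/
theorem sum_metric_mul_Riem {Γ G : Fin n → Fin n → Fin n → EuclideanSpace ℝ (Fin n) → ℝ}
    (hg : ∀ j k, Differentiable ℝ fun x => g x j k) (hΓ : ∀ m i j, Differentiable ℝ (Γ m i j))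
    (hG : ∀ m i j x, G m i j x = ∑ p, g x m p * Γ p i j x)
    (hcompat : ∀ i m k x, pd k (fun y => g y i m) x = G i m k x + G m i k x)
    (i j k l : Fin n) (x : EuclideanSpace ℝ (Fin n)) :
    ∑ m, g x i m * Riem Γ m j k l x = pd k (G i j l) x - pd l (G i j k) x
      - ∑ m, (G m i k x * Γ m j l x - G m i l x * Γ m j k x) := by
  have hpd : ∀ b c, pd c (G i j b) x =
      ∑ m, (g x i m * pd c (Γ m j b) x + (G i m c x + G m i c x) * Γ m j b x) := by
    intro b c
    have hfun : G i j b = fun y => ∑ p, g y i p * Γ p j b y := funext (hG i j b)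
    rw [hfun, pd_sum (F := fun p y => g y i p * Γ p j b y)
      fun p _ => (hg i p x).mul (hΓ p j b x)]
    exact Finset.sum_congr rfl fun p _ => by rw [pd_mul (hg i p x) (hΓ p j b x), hcompat]
  have hquad : ∑ m, g x i m * ∑ p, (Γ m p k x * Γ p j l x - Γ m p l x * Γ p j k x)
      = ∑ p, (G i p k x * Γ p j l x - G i p l x * Γ p j k x) := by
    simp only [hG, Finset.mul_sum, Finset.sum_mul, ← Finset.sum_sub_distrib]
    rw [Finset.sum_comm]
    exact Finset.sum_congr rfl fun p _ => Finset.sum_congr rfl fun m _ => by ring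
  simp only [Riem, mul_add, Finset.sum_add_distrib, hquad]
  rw [hpd l k, hpd k l]
  simp only [← Finset.sum_add_distrib, ← Finset.sum_sub_distrib]
  exact Finset.sum_congr rfl fun m _ => by ring

end MetricConnection

theorem statement2 {n : ℕ}
    (g ginv : EuclideanSpace ℝ (Fin n) → Fin n → Fin n → ℝ)
    (hg_smooth : ∀ j k, ContDiff ℝ (⊤ : ℕ∞) (fun x => g x j k))
    (hg_symm : ∀ x j k, g x j k = g x k j)
    -- g(x) is invertible at every point with pointwise inverse ginv
    (hinv : ∀ x i j, ∑ k, g x i k * ginv x k j = if i = j then (1:ℝ) else 0)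
    (hinv' : ∀ x i j, ∑ k, ginv x i k * g x k j = if i = j then (1:ℝ) else 0)
    -- A is a smooth totally antisymmetric (0,3)-tensor field
    (A : Fin n → Fin n → Fin n → EuclideanSpace ℝ (Fin n) → ℝ)
    (hA_smooth : ∀ i j k, ContDiff ℝ (⊤ : ℕ∞) (fun x => A i j k x))
    (hA_anti : ∀ i j k x, A i j k x = - A j i k x ∧ A i j k x = - A i k j x ∧
      A i j k x = - A k j i x)
    -- Γ = Γ0 + g⁻¹A and its torsion dual Γ⋆^m_{ij} = Γ^m_{ji}
    (Γ0u Γ Γs : Fin n → Fin n → Fin n → EuclideanSpace ℝ (Fin n) → ℝ)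
    (hΓ0u : ∀ m i j x, Γ0u m i j x = ∑ l, ginv x m l * LC g l i j x)
    (hΓ : ∀ m i j x, Γ m i j x = Γ0u m i j x + ∑ l, ginv x m l * A l i j x)
    (hΓs : ∀ m i j x, Γs m i j x = Γ m j i x) :
    (∀ i j k l x,
      (∑ m, g x i m * Riem Γ m j k l x) + (∑ m, g x j m * Riem Γs m i k l x)
        = 2 * (covD g ginv A k i j l x - covD g ginv A l i j k x)) ∧
    ((∀ m j k l x, Riem Γ m j k l x = 0) →
      ∀ i j k l x, (∑ m, g x j m * Riem Γs m i k l x)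
        = 2 * (covD g ginv A k i j l x - covD g ginv A l i j k x)) := by
  have hmul : ∀ x, Matrix.of (ginv x) * Matrix.of (g x) = 1 := fun x => by
    ext i j
    simpa [Matrix.mul_apply, Matrix.one_apply] using hinv' x i j
  have hginv_symm : ∀ x a b, ginv x a b = ginv x b a := by
    intro x a b
    have hT : (Matrix.of (g x)).transpose = Matrix.of (g x) := by
      ext i j
      exact hg_symm x j i
    have h := Matrix.transpose_nonsing_inv (Matrix.of (g x))
    rw [hT, Matrix.inv_eq_left_inv (hmul x)] at h
    exact congrFun (congrFun h b) a
  have hginv_smooth : ∀ i j, ContDiff ℝ (⊤ : ℕ∞) fun x => ginv x i j := by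
    have hdet : ∀ x, (Matrix.of (g x)).det ≠ 0 := fun x =>
      ((Matrix.isUnit_iff_isUnit_det _).1 (.of_mul_eq_one_right _ (hmul x))).ne_zero
    intro i j
    have h := ContDiff.matrix_inv_apply (M := fun x => Matrix.of (g x)) hg_smooth hdet i j
    have hfun : (fun x => ginv x i j) = fun x => (Matrix.of (g x))⁻¹ i j := by
      funext x
      rw [Matrix.inv_eq_left_inv (hmul x)]
      rfl
    rwa [hfun]
  have hΓ' : ∀ m i j x, Γ m i j x = ∑ c, ginv x m c * (LC g c i j x + A c i j x) := by
    intro m i j x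
    rw [hΓ, hΓ0u]
    simp only [mul_add, Finset.sum_add_distrib]
  have hA1 : ∀ i j k x, A i j k x = -A j i k x := fun i j k x => (hA_anti i j k x).1
  have hA2 : ∀ i j k x, A i j k x = -A i k j x := fun i j k x => (hA_anti i j k x).2.1
  have hΓs' : ∀ m i j x, Γs m i j x = ∑ c, ginv x m c * (LC g c i j x + -A c i j x) := by
    intro m i j x
    rw [hΓs, hΓ']
    exact Finset.sum_congr rfl fun c _ => by rw [LC_symm hg_symm c j i, hA2 c j i]
  have hg_diff : ∀ j k, Differentiable ℝ fun x => g x j k :=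
    fun j k => (hg_smooth j k).differentiable (by simp)
  have hA_diff : ∀ i j k, Differentiable ℝ (A i j k) :=
    fun i j k => (hA_smooth i j k).differentiable (by simp)
  have hLC_diff : ∀ k i j, Differentiable ℝ (LC g k i j) :=
    fun k i j => (contDiff_LC hg_smooth k i j).differentiable (by simp)
  have hginv_diff : ∀ j k, Differentiable ℝ fun x => ginv x j k :=
    fun j k => (hginv_smooth j k).differentiable (by simp)
  have hΓ_diff : ∀ m i j, Differentiable ℝ (Γ m i j) := by
    intro m i j
    rw [show Γ m i j = _ from funext (hΓ' m i j)]
    exact Differentiable.fun_sum fun c _ =>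
      (hginv_diff m c).mul ((hLC_diff c i j).add (hA_diff c i j))
  have hΓs_diff : ∀ m i j, Differentiable ℝ (Γs m i j) := by
    intro m i j
    rw [show Γs m i j = Γ m j i from funext (hΓs m i j)]
    exact hΓ_diff m j i
  have hlower : ∀ x m (v : Fin n → ℝ), v m = ∑ p, g x m p * ∑ c, ginv x p c * v c := by
    intro x m v
    simp only [Finset.mul_sum, ← mul_assoc]
    rw [Finset.sum_comm]
    simp [← Finset.sum_mul, hinv]
  have hmain : ∀ i j k l x,
      (∑ m, g x i m * Riem Γ m j k l x) + (∑ m, g x j m * Riem Γs m i k l x)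
        = 2 * (covD g ginv A k i j l x - covD g ginv A l i j k x) := by
    intro i j k l x
    rw [sum_metric_mul_Riem (Γ := Γ) (G := fun m i j x => LC g m i j x + A m i j x)
        hg_diff hΓ_diff
        (fun m i j x => by
          simp only [hΓ']
          exact hlower x m fun c => LC g c i j x + A c i j x)
        (fun i m k x => by rw [← LC_add_LC hg_symm, hA1 i m k]; ring),
      sum_metric_mul_Riem (Γ := Γs) (G := fun m i j x => LC g m i j x + -A m i j x)
        hg_diff hΓs_diff
        (fun m i j x => by
          simp only [hΓs']
          exact hlower x m fun c => LC g c i j x + -A c i j x)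
        (fun i m k x => by rw [← LC_add_LC hg_symm, hA1 i m k]; ring)]
    have hderiv : ∀ b c, pd c (fun y => LC g i j b y + A i j b y) x
        + pd c (fun y => LC g j i b y + -A j i b y) x
        = pd c (pd b fun y => g y i j) x + 2 * pd c (A i j b) x := by
      intro b c
      have hd : DifferentiableAt ℝ (pd b fun y => g y i j) x :=
        ((contDiff_pd (hg_smooth i j) b).differentiable (by simp)).differentiableAt
      have hsum := pd_add (f := fun y => LC g i j b y + A i j b y)
        (h := fun y => LC g j i b y + -A j i b y) ((hLC_diff i j b x).add (hA_diff i j b x))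
        ((hLC_diff j i b x).add (hA_diff j i b x).neg) c
      rw [← pd_const_mul (hA_diff i j b x), ← pd_add hd ((hA_diff i j b x).const_mul 2), ← hsum]
      congr 1
      funext y
      rw [← LC_add_LC hg_symm, hA1 j i b]
      ring
    let Q : (Fin n → ℝ) → (Fin n → ℝ) → ℝ := fun u v => ∑ m, u m * ∑ c, ginv x m c * v c
    have hQ_symm : ∀ u v, Q u v = Q v u := by
      intro u v
      simp only [Q, Finset.mul_sum]
      rw [Finset.sum_comm]
      exact Finset.sum_congr rfl fun a _ => Finset.sum_congr rfl fun b _ => by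
        rw [hginv_symm x b a]; ring
    have hQ_sub : ∀ u v w z : Fin n → ℝ, ∑ m, (u m * (∑ c, ginv x m c * v c)
        - w m * ∑ c, ginv x m c * z c) = Q u v - Q w z := fun u v w z => by
      simp only [Q, Finset.sum_sub_distrib]
    have hQ_add : ∀ u v w z : Fin n → ℝ, Q (fun m => u m + v m) (fun m => w m + z m)
        = Q u w + Q u z + Q v w + Q v z := fun u v w z => by
      simp only [Q, mul_add, add_mul, Finset.sum_add_distrib]
      ring
    have hQ_neg_left : ∀ u v : Fin n → ℝ, Q (fun m => -u m) v = -Q u v := fun u v => by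
      simp [Q]
    have hQ_neg_right : ∀ u v : Fin n → ℝ, Q u (fun m => -v m) = -Q u v := fun u v => by
      simp [Q]
    have hcovD : ∀ a b, covD g ginv A a i j b x = pd a (A i j b) x
        - (Q (fun m => A m j b x) (fun m => LC g m i a x)
          - Q (fun m => A m i b x) (fun m => LC g m j a x)
          + Q (fun m => A i j m x) (fun m => LC g m b a x)) := by
      intro a b
      simp only [covD, Q, ← Finset.sum_sub_distrib, ← Finset.sum_add_distrib]
      congr 1
      exact Finset.sum_congr rfl fun m _ => by rw [hA1 i m b]; ring
    simp only [hΓ', hΓs']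
    rw [hQ_sub (fun m => LC g m i k x + A m i k x) (fun m => LC g m j l x + A m j l x)
        (fun m => LC g m i l x + A m i l x) (fun m => LC g m j k x + A m j k x),
      hQ_sub (fun m => LC g m j k x + -A m j k x) (fun m => LC g m i l x + -A m i l x)
        (fun m => LC g m j l x + -A m j l x) (fun m => LC g m i k x + -A m i k x),
      hcovD, hcovD]
    simp only [hQ_add, hQ_neg_left, hQ_neg_right, LC_symm hg_symm _ l k]
    have hcomm := pd_comm (x := x) (hg_smooth i j) k l
    linear_combination hderiv l k - hderiv k l + hcomm
      - hQ_symm (fun m => LC g m i k x) (fun m => LC g m j l x)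
      + hQ_symm (fun m => LC g m i l x) (fun m => LC g m j k x)
      - hQ_symm (fun m => A m i k x) (fun m => A m j l x)
      + hQ_symm (fun m => A m i l x) (fun m => A m j k x)
      - hQ_symm (fun m => LC g m i k x) (fun m => A m j l x)
      + hQ_symm (fun m => LC g m i l x) (fun m => A m j k x)
      + hQ_symm (fun m => A m i k x) (fun m => LC g m j l x)
      - hQ_symm (fun m => A m i l x) (fun m => LC g m j k x)
  refine ⟨hmain, fun hflat i j k l x => ?_⟩
  simpa [hflat] using hmain i j k l x
end
end

section
/- Let g be a smooth metric on ℝ^n whose matrix g(x) is invertible at every point, with pointwise inverse g^{··}, let Γ0_{kij} = ½(∂_i g_{jk} + ∂_j g_{ik} − ∂_k g_{ij}), Γ0^m_{ij} = Σ_l g^{ml} Γ0_{lij}, and let A_{ijk} : ℝ^n → ℝ be a smooth totally antisymmetric (0,3)-tensor field. Define Γ^m_{ij} = Γ0^m_{ij} + Σ_l g^{ml} A_{lij} and let Γ⋆ be its torsion dual, Γ⋆^m_{ij} = Γ^m_{ji}. Define the Ricci scalar of a connection Γ' by Ric(Γ')(x) = Σ_{i,j,m} g^{ij}(x) · R(Γ')^m_{imj}(x).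 Then Ric(Γ)(x) = Ric(Γ⋆)(x) at every point x; in particular Γ is scalar-flat (Ric(Γ) ≡ 0) if and only if Γ⋆ is scalar-flat. -/
noncomputable section
open scoped BigOperators

/-- Ricci scalar Ric(Γ)(x) = Σ_{i,j,m} g^{ij} R(Γ)^m_{imj}. -/
def RicciScalar {n : ℕ} (ginv : EuclideanSpace ℝ (Fin n) → Fin n → Fin n → ℝ)
    (Γ : Fin n → Fin n → Fin n → EuclideanSpace ℝ (Fin n) → ℝ)
    (x : EuclideanSpace ℝ (Fin n)) : ℝ :=
  ∑ i, ∑ j, ∑ m, ginv x i j * Riem Γ m i m j x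

/-- The trace of the derivative of a connection only depends on its trace. -/
theorem sum_pd_eq_of_sum_eq {n : ℕ} (j : Fin n)
    {F G : Fin n → EuclideanSpace ℝ (Fin n) → ℝ}
    (hF : ∀ m, Differentiable ℝ (F m)) (hG : ∀ m, Differentiable ℝ (G m))
    (h : ∀ x, ∑ m, F m x = ∑ m, G m x) (x : EuclideanSpace ℝ (Fin n)) :
    ∑ m, pd j (F m) x = ∑ m, pd j (G m) x := by
  have key : ∀ H : Fin n → EuclideanSpace ℝ (Fin n) → ℝ, (∀ m, Differentiable ℝ (H m)) →
      ∑ m, pd j (H m) x = pd j (fun y => ∑ m, H m y) x := by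
    intro H hH
    unfold pd
    rw [fderiv_fun_sum fun m _ => hH m x, sum_apply]
  rw [key F hF, key G hG, funext h]

/-- The Ricci scalar with respect to a symmetric inverse metric is invariant under exchanging the
lower indices of a connection whose two traces agree. -/
theorem RicciScalar_eq_of_swap {n : ℕ}
    {ginv : EuclideanSpace ℝ (Fin n) → Fin n → Fin n → ℝ}
    {Γ Γs : Fin n → Fin n → Fin n → EuclideanSpace ℝ (Fin n) → ℝ}
    (hsymm : ∀ x i j, ginv x i j = ginv x j i)
    (hd : ∀ m i j, Differentiable ℝ (Γ m i j))
    (htrace : ∀ i x, ∑ m, Γ m i m x = ∑ m, Γ m m i x)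
    (hΓs : ∀ m i j x, Γs m i j x = Γ m j i x) (x : EuclideanSpace ℝ (Fin n)) :
    RicciScalar ginv Γ x = RicciScalar ginv Γs x := by
  obtain rfl : Γs = fun m i j => Γ m j i := by
    funext m i j x
    exact hΓs m i j x
  have expand : ∀ C : Fin n → Fin n → Fin n → EuclideanSpace ℝ (Fin n) → ℝ,
      RicciScalar ginv C x =
        (∑ i, ∑ j, ginv x i j * ∑ m, pd m (C m i j) x)
        - (∑ i, ∑ j, ginv x i j * ∑ m, pd j (C m i m) x)
        + (∑ i, ∑ j, ginv x i j * ∑ l, (∑ m, C m l m x) * C l i j x)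
        - ∑ i, ∑ j, ginv x i j * ∑ m, ∑ l, C m l j x * C l i m x := by
    intro C
    simp only [RicciScalar, Riem, ← Finset.sum_sub_distrib, ← Finset.sum_add_distrib, ← mul_sub,
      ← mul_add]
    refine Finset.sum_congr rfl fun i _ => Finset.sum_congr rfl fun j _ => ?_
    rw [← Finset.mul_sum]
    congr 1
    simp only [Finset.sum_sub_distrib, Finset.sum_add_distrib, Finset.sum_mul]
    rw [Finset.sum_comm (f := fun l m => C m l m x * C l i j x)]
    ring
  have hdiv : (∑ i, ∑ j, ginv x i j * ∑ m, pd m (Γ m i j) x)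
      = ∑ i, ∑ j, ginv x i j * ∑ m, pd m (Γ m j i) x := by
    rw [Finset.sum_comm]
    simp only [hsymm x]
  have hgrad : ∀ i j, ∑ m, pd j (Γ m i m) x = ∑ m, pd j (Γ m m i) x := fun i j =>
    sum_pd_eq_of_sum_eq j (fun m => hd m i m) (fun m => hd m m i) (htrace i) x
  have htr : (∑ i, ∑ j, ginv x i j * ∑ l, (∑ m, Γ m l m x) * Γ l i j x)
      = ∑ i, ∑ j, ginv x i j * ∑ l, (∑ m, Γ m m l x) * Γ l j i x := by
    rw [Finset.sum_comm]
    simp only [hsymm x, htrace]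
  have hquad : (∑ i, ∑ j, ginv x i j * ∑ m, ∑ l, Γ m l j x * Γ l i m x)
      = ∑ i, ∑ j, ginv x i j * ∑ m, ∑ l, Γ m j l x * Γ l m i x := by
    rw [Finset.sum_comm]
    refine Finset.sum_congr rfl fun i _ => Finset.sum_congr rfl fun j _ => ?_
    rw [hsymm x j i, Finset.sum_comm]
    simp only [mul_comm]
  rw [expand, expand, hdiv, htr, hquad]
  simp only [hgrad]

/-- The determinant of a matrix of differentiable functions is differentiable. -/
theorem differentiable_det {E : Type*} [NormedAddCommGroup E] [NormedSpace ℝ E] {n : ℕ}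
    {M : E → Matrix (Fin n) (Fin n) ℝ} (hM : ∀ i j, Differentiable ℝ fun x => M x i j) :
    Differentiable ℝ fun x => (M x).det := by
  simp only [Matrix.det_apply']
  fun_prop

/-- The entries of a pointwise inverse of a matrix of differentiable functions are
differentiable. -/
theorem differentiable_of_mul_eq_one {E : Type*} [NormedAddCommGroup E] [NormedSpace ℝ E] {n : ℕ}
    {M N : E → Matrix (Fin n) (Fin n) ℝ} (hM : ∀ i j, Differentiable ℝ fun x => M x i j)
    (h : ∀ x, M x * N x = 1) (i j : Fin n) : Differentiable ℝ fun x => N x i j := by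
  have hdet : ∀ x, (M x).det ≠ 0 := fun x =>
    ((Matrix.isUnit_iff_isUnit_det _).1 (IsUnit.of_mul_eq_one _ (h x))).ne_zero
  have hN : (fun x => N x i j) = fun x => (M x).det⁻¹ * (M x).adjugate i j := by
    funext x
    rw [← Matrix.inv_eq_right_inv (h x), Matrix.inv_def, Ring.inverse_eq_inv', Matrix.smul_apply,
      smul_eq_mul]
  rw [hN]
  refine ((differentiable_det hM).inv hdet).mul ?_
  simp only [Matrix.adjugate_apply]
  refine differentiable_det fun k l => ?_
  by_cases hk : k = j
  · simp [hk]
  · simpa [Matrix.updateRow_ne hk] using hM k l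

theorem differentiable_pd {n : ℕ} (i : Fin n) {f : EuclideanSpace ℝ (Fin n) → ℝ}
    (hf : ContDiff ℝ (⊤ : ℕ∞) f) : Differentiable ℝ (pd i f) :=
  ((hf.fderiv_right (m := 1) (by norm_cast)).differentiable one_ne_zero).clm_apply
    (differentiable_const _)

/-- A symmetric form and a form antisymmetric in the same two indices contract to zero. -/
theorem sum_symm_mul_antisymm {ι : Type*} [Fintype ι] {s a : ι → ι → ℝ}
    (hs : ∀ i j, s i j = s j i) (ha : ∀ i j, a i j = -a j i) :
    ∑ i, ∑ j, s i j * a i j = 0 := by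
  have h : ∑ i, ∑ j, s i j * a i j = -∑ i, ∑ j, s i j * a i j := by
    conv_lhs => rw [Finset.sum_comm]
    simp only [← Finset.sum_neg_distrib]
    refine Finset.sum_congr rfl fun i _ => Finset.sum_congr rfl fun j _ => ?_
    rw [hs j i, ha j i, mul_neg]
  linarith

theorem statement3 {n : ℕ}
    (g ginv : EuclideanSpace ℝ (Fin n) → Fin n → Fin n → ℝ)
    (hg_smooth : ∀ j k, ContDiff ℝ (⊤ : ℕ∞) (fun x => g x j k))
    (hg_symm : ∀ x j k, g x j k = g x k j)
    -- g(x) is invertible at every point with pointwise inverse ginv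
    (hinv : ∀ x i j, ∑ k, g x i k * ginv x k j = if i = j then (1:ℝ) else 0)
    (hinv' : ∀ x i j, ∑ k, ginv x i k * g x k j = if i = j then (1:ℝ) else 0)
    -- A is a smooth totally antisymmetric (0,3)-tensor field
    (A : Fin n → Fin n → Fin n → EuclideanSpace ℝ (Fin n) → ℝ)
    (hA_smooth : ∀ i j k, ContDiff ℝ (⊤ : ℕ∞) (fun x => A i j k x))
    (hA_anti : ∀ i j k x, A i j k x = - A j i k x ∧ A i j k x = - A i k j x ∧
      A i j k x = - A k j i x)
    -- Γ = Γ0 + g⁻¹A and its torsion dual Γ⋆^m_{ij} = Γ^m_{ji}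
    (Γ0u Γ Γs : Fin n → Fin n → Fin n → EuclideanSpace ℝ (Fin n) → ℝ)
    (hΓ0u : ∀ m i j x, Γ0u m i j x = ∑ l, ginv x m l * LC g l i j x)
    (hΓ : ∀ m i j x, Γ m i j x = Γ0u m i j x + ∑ l, ginv x m l * A l i j x)
    (hΓs : ∀ m i j x, Γs m i j x = Γ m j i x) :
    (∀ x, RicciScalar ginv Γ x = RicciScalar ginv Γs x) ∧
    ((∀ x, RicciScalar ginv Γ x = 0) ↔ (∀ x, RicciScalar ginv Γs x = 0)) := by
  have hmul : ∀ x, Matrix.of (g x) * Matrix.of (ginv x) = 1 := by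
    intro x
    ext i j
    simpa [Matrix.mul_apply, Matrix.one_apply] using hinv x i j
  have hsymm : ∀ x i j, ginv x i j = ginv x j i := by
    intro x i j
    have hg : (Matrix.of (g x)).IsSymm := by
      ext i j
      exact hg_symm x j i
    have hi : (Matrix.of (ginv x)).IsSymm := by
      rw [← Matrix.inv_eq_right_inv (hmul x), Matrix.IsSymm, Matrix.transpose_nonsing_inv, hg.eq]
    exact hi.apply j i
  have hginv : ∀ i j, Differentiable ℝ fun x => ginv x i j :=
    differentiable_of_mul_eq_one (M := fun x => Matrix.of (g x)) (N := fun x => Matrix.of (ginv x))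
      (fun j k => (hg_smooth j k).differentiable (by simp)) hmul
  have hLC : ∀ k i j, Differentiable ℝ (LC g k i j) := by
    intro k i j
    have h₁ := differentiable_pd i (hg_smooth j k)
    have h₂ := differentiable_pd j (hg_smooth i k)
    have h₃ := differentiable_pd k (hg_smooth i j)
    unfold LC
    fun_prop
  have hA : ∀ i j k, Differentiable ℝ (A i j k) := fun i j k =>
    (hA_smooth i j k).differentiable (by simp)
  have hd : ∀ m i j, Differentiable ℝ (Γ m i j) := by
    intro m i j
    rw [funext (hΓ m i j)]
    simp only [hΓ0u]
    fun_prop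
  have hLC_symm : ∀ k i j x, LC g k i j x = LC g k j i x := by
    intro k i j x
    simp only [LC, hg_symm _ i j]
    ring
  have hA_trace : ∀ i x, ∑ m, ∑ l, ginv x m l * A l i m x = 0 := fun i x =>
    sum_symm_mul_antisymm (hsymm x) fun m l => (hA_anti l i m x).2.2
  have htrace : ∀ i x, ∑ m, Γ m i m x = ∑ m, Γ m m i x := by
    intro i x
    have h : ∑ m, ∑ l, ginv x m l * A l m i x = 0 := by
      rw [← neg_eq_zero, ← hA_trace i x]
      simp only [← Finset.sum_neg_distrib, ← mul_neg, ← (hA_anti _ _ _ x).2.1]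
    simp only [hΓ, hΓ0u, Finset.sum_add_distrib, hA_trace, h]
    simp only [hLC_symm _ i]
  have hRic := RicciScalar_eq_of_swap hsymm hd htrace hΓs
  exact ⟨hRic, by simp only [hRic]⟩
end
end

section
/- Let Γ1, Γ2 be connection coefficient fields on ℝ^n that are differentiable at a point x, let t ∈ ℝ, set Γ = t·Γ1 + (1−t)·Γ2 and K^k_{ij} = Γ1^k_{ij} − Γ2^k_{ij}, and let g^{··} : ℝ^n → (Fin n → Fin n → ℝ) be a symmetric matrix-valued function (the inverse metric). Define the Ricci scalar of a connection Γ' by Ric(Γ')(x) = Σ_{i,j,m} g^{ij}(x) · R(Γ')^m_{imj}(x). Then at x: Ric(Γ) = t·Ric(Γ1) + (1−t)·Ric(Γ2) − t(1−t)·( Σ_{i,j,l,m} g^{ij} K^m_{lm} K^l_{ij} − Σ_{i,j,l,m} g^{ij} K^m_{lj} K^l_{im} ). -/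
noncomputable section
open scoped BigOperators

/-- Partial derivatives commute with linear combinations of differentiable functions. -/
lemma pd_linear_combination {n : ℕ} (i : Fin n) {f₁ f₂ : EuclideanSpace ℝ (Fin n) → ℝ}
    {x : EuclideanSpace ℝ (Fin n)} (hf₁ : DifferentiableAt ℝ f₁ x)
    (hf₂ : DifferentiableAt ℝ f₂ x) (a b : ℝ) :
    pd i (fun y => a * f₁ y + b * f₂ y) x = a * pd i f₁ x + b * pd i f₂ x := by
  have h := (hf₁.hasFDerivAt.const_mul a).add (hf₂.hasFDerivAt.const_mul b)
  simp only [pd]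
  erw [h.fderiv]
  simp

/-- The curvature of an affine combination of connections: the defect from affinity is quadratic
in the difference of the connections. -/
lemma Riem_affine_combination {n : ℕ}
    {Γ₁ Γ₂ : Fin n → Fin n → Fin n → EuclideanSpace ℝ (Fin n) → ℝ}
    {x : EuclideanSpace ℝ (Fin n)}
    (hΓ₁ : ∀ m i j, DifferentiableAt ℝ (Γ₁ m i j) x)
    (hΓ₂ : ∀ m i j, DifferentiableAt ℝ (Γ₂ m i j) x) (t : ℝ) (m i j k : Fin n) :
    Riem (fun m i j y => t * Γ₁ m i j y + (1 - t) * Γ₂ m i j y) m i j k x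
      = t * Riem Γ₁ m i j k x + (1 - t) * Riem Γ₂ m i j k x
        - t * (1 - t) *
          ∑ l, ((Γ₁ m l j x - Γ₂ m l j x) * (Γ₁ l i k x - Γ₂ l i k x)
            - (Γ₁ m l k x - Γ₂ m l k x) * (Γ₁ l i j x - Γ₂ l i j x)) := by
  have hsum : ∑ l, ((t * Γ₁ m l j x + (1 - t) * Γ₂ m l j x)
          * (t * Γ₁ l i k x + (1 - t) * Γ₂ l i k x)
        - (t * Γ₁ m l k x + (1 - t) * Γ₂ m l k x)
          * (t * Γ₁ l i j x + (1 - t) * Γ₂ l i j x))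
      = t * ∑ l, (Γ₁ m l j x * Γ₁ l i k x - Γ₁ m l k x * Γ₁ l i j x)
        + (1 - t) * ∑ l, (Γ₂ m l j x * Γ₂ l i k x - Γ₂ m l k x * Γ₂ l i j x)
        - t * (1 - t) *
          ∑ l, ((Γ₁ m l j x - Γ₂ m l j x) * (Γ₁ l i k x - Γ₂ l i k x)
            - (Γ₁ m l k x - Γ₂ m l k x) * (Γ₁ l i j x - Γ₂ l i j x)) := by
    simp only [Finset.mul_sum, ← Finset.sum_add_distrib, ← Finset.sum_sub_distrib]
    exact Finset.sum_congr rfl fun l _ => by ring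
  simp only [Riem, pd_linear_combination _ (hΓ₁ _ _ _) (hΓ₂ _ _ _), hsum]
  ring

theorem statement11 {n : ℕ}
    (Γ1 Γ2 : Fin n → Fin n → Fin n → EuclideanSpace ℝ (Fin n) → ℝ)
    (x : EuclideanSpace ℝ (Fin n))
    (hΓ1 : ∀ m i j, DifferentiableAt ℝ (Γ1 m i j) x)
    (hΓ2 : ∀ m i j, DifferentiableAt ℝ (Γ2 m i j) x)
    (t : ℝ)
    -- the convex linear combination Γ = t·Γ1 + (1−t)·Γ2
    (Γ : Fin n → Fin n → Fin n → EuclideanSpace ℝ (Fin n) → ℝ)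
    (hΓ : ∀ k i j y, Γ k i j y = t * Γ1 k i j y + (1 - t) * Γ2 k i j y)
    -- difference tensor K = Γ1 − Γ2
    (K : Fin n → Fin n → Fin n → EuclideanSpace ℝ (Fin n) → ℝ)
    (hK : ∀ k i j y, K k i j y = Γ1 k i j y - Γ2 k i j y)
    -- a symmetric inverse-metric field g^{ij}
    (ginv : EuclideanSpace ℝ (Fin n) → Fin n → Fin n → ℝ)
    (hginv_symm : ∀ y i j, ginv y i j = ginv y j i) :
    RicciScalar ginv Γ x
      = t * RicciScalar ginv Γ1 x + (1 - t) * RicciScalar ginv Γ2 x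
        - t * (1 - t) *
          ((∑ i, ∑ j, ∑ l, ∑ m, ginv x i j * K m l m x * K l i j x)
            - ∑ i, ∑ j, ∑ l, ∑ m, ginv x i j * K m l j x * K l i m x) := by
  obtain rfl : Γ = fun k i j y => t * Γ1 k i j y + (1 - t) * Γ2 k i j y := by
    funext k i j y
    exact hΓ k i j y
  have hquad : (∑ i, ∑ j, ∑ l, ∑ m, ginv x i j * K m l m x * K l i j x)
        - ∑ i, ∑ j, ∑ l, ∑ m, ginv x i j * K m l j x * K l i m x
      = ∑ i, ∑ j, ∑ m, ginv x i j * ∑ l, (K m l m x * K l i j x - K m l j x * K l i m x) := by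
    simp only [← Finset.sum_sub_distrib, Finset.mul_sum]
    refine Finset.sum_congr rfl fun i _ => Finset.sum_congr rfl fun j _ => ?_
    rw [Finset.sum_comm]
    exact Finset.sum_congr rfl fun m _ => Finset.sum_congr rfl fun l _ => by ring
  rw [hquad]
  simp only [RicciScalar, Riem_affine_combination hΓ1 hΓ2, hK]
  simp only [Finset.mul_sum _ _ t, Finset.mul_sum _ _ (1 - t), Finset.mul_sum _ _ (t * (1 - t)),
    ← Finset.sum_add_distrib, ← Finset.sum_sub_distrib]
  refine Finset.sum_congr rfl fun i _ => Finset.sum_congr rfl fun j _ =>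
    Finset.sum_congr rfl fun m _ => ?_
  simp only [← Finset.mul_sum]
  ring
end
end
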